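/- Let 𝔄 be a subshift, (G,·) a discrete abelian group, and Φ a cellular automaton of radius R with Φ(𝔄) ⊆ 𝔄. Suppose the induced endomorphism Φ_* : H¹_loc(𝔄,G) → H¹_loc(𝔄,G) is surjective. If a ∈ 𝔄̃ has a projective G-pole, then Φ(a) has a projective G-pole; consequently Φ^t(a) has a projective G-pole for every t ∈ ℕ, and the defect of a is Φ-persistent. -/

import Mathlib

open scoped ENNReal

namespace Defects

/-- The configuration space `A^(ℤ^D)`. -/
abbrev Config (D : ℕ) (A : Type) := (Fin D → ℤ) → A

variable {D : ℕ} {A : Type}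

/-- The shift `σ^v`. -/
def shift (v : Fin D → ℤ) (a : Config D A) : Config D A := fun z => a (z + v)

/-- A subshift: a nonempty closed shift-invariant subset of `A^(ℤ^D)`. -/
def IsSubshift [TopologicalSpace A] (𝔄 : Set (Config D A)) : Prop :=
  𝔄.Nonempty ∧ IsClosed 𝔄 ∧ ∀ v : Fin D → ℤ, shift v '' 𝔄 = 𝔄

/-- The cube `B(r) = [-r, r]^D ⊆ ℤ^D`. -/
def ballZ (D r : ℕ) : Set (Fin D → ℤ) := {w | ∀ i, |w i| ≤ (r : ℤ)}

/-- The `r`-block of `a` at `z`, as an element of `A^(B(r))`. -/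
def blockAt (r : ℕ) (a : Config D A) (z : Fin D → ℤ) : ballZ D r → A :=
  fun w => a (z + w.1)

/-- The set `𝔄_(r)` of admissible `r`-blocks. -/
def admissibleBlocks (𝔄 : Set (Config D A)) (r : ℕ) : Set (ballZ D r → A) :=
  (fun a => blockAt r a 0) '' 𝔄

/-- `G_R(a)`: the set of `z` where the `R`-block of `a` is admissible. -/
def goodSet (𝔄 : Set (Config D A)) (R : ℕ) (a : Config D A) : Set (Fin D → ℤ) :=
  {z | blockAt R a z ∈ admissibleBlocks 𝔄 R}

/-- `𝔄̃`: configurations having arbitrarily large admissible regions. -/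
def almostAdmissible (𝔄 : Set (Config D A)) : Set (Config D A) :=
  {a | ∀ R : ℕ, (goodSet 𝔄 R a).Nonempty}

/-- The defect of `a` is removable if some `a' ∈ 𝔄` agrees with `a` on `G_r(a)`. -/
def Removable (𝔄 : Set (Config D A)) (a : Config D A) : Prop :=
  ∃ r : ℕ, ∃ a' ∈ 𝔄, ∀ z ∈ goodSet 𝔄 r a, a' z = a z

/-- A cellular automaton: continuous and commuting with all shifts. -/
def IsCellularAutomaton [TopologicalSpace A] (Φ : Config D A → Config D A) : Prop :=
  Continuous Φ ∧ ∀ v : Fin D → ℤ, Φ ∘ shift v = shift v ∘ Φ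

/-- `Φ` has radius `R`: `Φ(a)(z)` depends only on the `R`-block of `a` at `z`. -/
def HasRadius {B : Type} (Φ : Config D A → Config D B) (R : ℕ) : Prop :=
  ∀ a b : Config D A, ∀ z : Fin D → ℤ, blockAt R a z = blockAt R b z → Φ a z = Φ b z

/-- `E = {±e_1, …, ±e_D}`. -/
def stdSteps (D : ℕ) : Set (Fin D → ℤ) :=
  {v | ∃ i : Fin D, v = Pi.single i 1 ∨ v = -Pi.single i 1}

/-- A subshift homomorphism `Φ : 𝔄 → 𝔅`. -/
def IsSubshiftHom {B : Type} [TopologicalSpace A] [TopologicalSpace B]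
    (𝔄 : Set (Config D A)) (𝔅 : Set (Config D B)) (Φ : Config D A → Config D B) : Prop :=
  Set.MapsTo Φ 𝔄 𝔅 ∧ ContinuousOn Φ 𝔄 ∧
    ∀ v : Fin D → ℤ, ∀ a ∈ 𝔄, Φ (shift v a) = shift v (Φ a)

/-- `Φ` has radius `R` as a map on `𝔄`. -/
def HomHasRadius {B : Type} (𝔄 : Set (Config D A)) (Φ : Config D A → Config D B)
    (R : ℕ) : Prop :=
  ∀ a ∈ 𝔄, ∀ a' ∈ 𝔄, ∀ z : Fin D → ℤ, blockAt R a z = blockAt R a' z → Φ a z = Φ a' z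

/-! ### Dynamical cocycles (multiplicative) -/

/-- A continuous `G`-valued (dynamical) cocycle on `𝔄`. -/
def DynCocycleOn [TopologicalSpace A] {G : Type} [Group G] [TopologicalSpace G] (𝔄 : Set (Config D A))
    (C : (Fin D → ℤ) → Config D A → G) : Prop :=
  (∀ z : Fin D → ℤ, ContinuousOn (C z) 𝔄) ∧
    ∀ y z : Fin D → ℤ, ∀ a ∈ 𝔄, C (y + z) a = C y (shift z a) * C z a

/-- Cohomologous cocycles, via a continuous transfer function. -/
def DynCohomologous [TopologicalSpace A] {G : Type} [Group G] [TopologicalSpace G] (𝔄 : Set (Config D A))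
    (C C' : (Fin D → ℤ) → Config D A → G) : Prop :=
  ∃ b : Config D A → G, ContinuousOn b 𝔄 ∧
    ∀ z : Fin D → ℤ, ∀ a ∈ 𝔄, C' z a = b (shift z a) * C z a * (b a)⁻¹

/-- A trivial cocycle: cohomologous to a homomorphism `ℤ^D → G`. -/
def DynTrivial [TopologicalSpace A] {G : Type} [Group G] [TopologicalSpace G] (𝔄 : Set (Config D A))
    (C : (Fin D → ℤ) → Config D A → G) : Prop :=
  ∃ h : (Fin D → ℤ) → G, (∀ y z : Fin D → ℤ, h (y + z) = h y * h z) ∧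
    DynCohomologous 𝔄 C (fun z _ => h z)

/-- A cocycle is locally determined with radius `r` if `C(e, ·)` (for `e ∈ E`)
depends only on the `r`-block at `0`. -/
def LocallyDetermined {G : Type} [Group G] (𝔅 : Set (Config D A))
    (C : (Fin D → ℤ) → Config D A → G) (r : ℕ) : Prop :=
  ∀ e ∈ stdSteps D, ∀ b ∈ 𝔅, ∀ b' ∈ 𝔅,
    blockAt r b 0 = blockAt r b' 0 → C e b = C e b'

/-- A fundamental cocycle: every continuous cocycle into a discrete group is
cohomologous to a homomorphic image of `Cstar`. -/
def IsFundamental [TopologicalSpace A] {Gs : Type} [Group Gs] [TopologicalSpace Gs] (𝔄 : Set (Config D A))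
    (Cstar : (Fin D → ℤ) → Config D A → Gs) : Prop :=
  ∀ (H : Type) [Group H] [TopologicalSpace H] [DiscreteTopology H],
    ∀ C : (Fin D → ℤ) → Config D A → H,
      DynCocycleOn 𝔄 C → ∃ ψ : Gs →* H, DynCohomologous 𝔄 C fun z a => ψ (Cstar z a)


/-! ### Trails and locally determined cocycles via local rules -/

/-- A trail: a nonempty sequence in `ℤ^D` whose successive steps lie in `E`. -/
def IsTrail (ζ : List (Fin D → ℤ)) : Prop :=
  ζ ≠ [] ∧ ζ.Chain' fun x y => y - x ∈ stdSteps D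

/-- The trail `ζ` lies in `Y`. -/
def TrailIn (Y : Set (Fin D → ℤ)) (ζ : List (Fin D → ℤ)) : Prop := ∀ z ∈ ζ, z ∈ Y

/-- A closed trail: the first and last points coincide. -/
def IsClosedTrail (ζ : List (Fin D → ℤ)) : Prop := ζ.head? = ζ.getLast?

/-- Concatenation of trails (the final point of `ζ` should equal the initial
point of `ξ`). -/
def trailConcat (ζ ξ : List (Fin D → ℤ)) : List (Fin D → ℤ) := ζ ++ ξ.tail

/-- The value `c(ζ, a)` of a local rule along a trail, later steps multiplied
on the left. -/
def trailVal {G : Type} [Group G] {r : ℕ} (c : (Fin D → ℤ) → (ballZ D r → A) → G)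
    (a : Config D A) : List (Fin D → ℤ) → G
  | [] => 1
  | [_] => 1
  | x :: y :: rest => trailVal c a (y :: rest) * c (y - x) (blockAt r a x)

/-- A local rule of radius `r` for a `G`-valued cocycle on `𝔄`. -/
def IsLocalRule {G : Type} [Group G] (𝔄 : Set (Config D A)) (r : ℕ)
    (c : (Fin D → ℤ) → (ballZ D r → A) → G) : Prop :=
  ∀ a : Config D A, ∀ e ∈ stdSteps D, ∀ e' ∈ stdSteps D,
    ((0 ∈ goodSet 𝔄 r a ∧ e ∈ goodSet 𝔄 r a ∧ e' ∈ goodSet 𝔄 r a ∧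
        e + e' ∈ goodSet 𝔄 r a) →
      c e' (blockAt r a e) * c e (blockAt r a 0) =
        c e (blockAt r a e') * c e' (blockAt r a 0)) ∧
    ((0 ∈ goodSet 𝔄 r a ∧ e ∈ goodSet 𝔄 r a) →
      c (-e) (blockAt r a e) = (c e (blockAt r a 0))⁻¹)

/-- Elementary `Y`-homotopies of trails. -/
inductive ElemHomotopy (Y : Set (Fin D → ℤ)) :
    List (Fin D → ℤ) → List (Fin D → ℤ) → Prop
  | slide (pre post : List (Fin D → ℤ)) (x y z : Fin D → ℤ)
      (hxy : y - x ∈ stdSteps D) (hyz : z - y ∈ stdSteps D) (hw : x + z - y ∈ Y) :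
      ElemHomotopy Y (pre ++ x :: y :: z :: post) (pre ++ x :: (x + z - y) :: z :: post)
  | delBacktrack (pre post : List (Fin D → ℤ)) (x y : Fin D → ℤ)
      (hstep : y - x ∈ stdSteps D) :
      ElemHomotopy Y (pre ++ x :: y :: x :: post) (pre ++ x :: post)
  | insBacktrack (pre post : List (Fin D → ℤ)) (x y : Fin D → ℤ)
      (hy : y ∈ Y) (hstep : y - x ∈ stdSteps D) :
      ElemHomotopy Y (pre ++ x :: post) (pre ++ x :: y :: x :: post)

/-- Two trails are `Y`-homotopic if joined by a finite chain of elementary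
`Y`-homotopies. -/
def TrailHomotopic (Y : Set (Fin D → ℤ)) : List (Fin D → ℤ) → List (Fin D → ℤ) → Prop :=
  Relation.ReflTransGen fun p q => ElemHomotopy Y p q ∨ ElemHomotopy Y q p

/-- Points `z`, `y` joined by a trail lying in `Y`. -/
def TrailConnIn (Y : Set (Fin D → ℤ)) (z y : Fin D → ℤ) : Prop :=
  ∃ (ζ : List (Fin D → ℤ)) (h : ζ ≠ []),
    IsTrail ζ ∧ TrailIn Y ζ ∧ ζ.head h = z ∧ ζ.getLast h = y

/-- `a` has a projective `c`-pole: for every `R ≥ r` there is a closed trail in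
`G_R(a)` with nontrivial value. -/
def HasProjPole {G : Type} [Group G] (𝔄 : Set (Config D A)) (r : ℕ)
    (c : (Fin D → ℤ) → (ballZ D r → A) → G) (a : Config D A) : Prop :=
  ∀ R : ℕ, r ≤ R → ∃ ζ : List (Fin D → ℤ),
    IsTrail ζ ∧ IsClosedTrail ζ ∧ TrailIn (goodSet 𝔄 R a) ζ ∧ trailVal c a ζ ≠ 1

/-- Restriction of a `ρ`-block to an `r`-block (`r ≤ ρ`). -/
def restrictBlock {r ρ : ℕ} (h : r ≤ ρ) (p : ballZ D ρ → A) : ballZ D r → A :=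
  fun w => p ⟨w.1, by
    intro i
    exact le_trans (w.2 i) (by exact_mod_cast h)⟩

/-- The lift of a local rule of radius `r` to radius `ρ ≥ r`. -/
def liftRule {G : Type} [Group G] {r ρ : ℕ} (h : r ≤ ρ)
    (c : (Fin D → ℤ) → (ballZ D r → A) → G) :
    (Fin D → ℤ) → (ballZ D ρ → A) → G :=
  fun e p => c e (restrictBlock h p)

/-- Local rules of radius `ρ` are locally cohomologous via a local transfer
function of some radius `s ≤ ρ`. -/
def LocallyCohomologous {G : Type} [Group G] (𝔄 : Set (Config D A)) (ρ : ℕ)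
    (c₁ c₂ : (Fin D → ℤ) → (ballZ D ρ → A) → G) : Prop :=
  ∃ (s : ℕ) (_ : s ≤ ρ) (b : (ballZ D s → A) → G),
    ∀ a : Config D A, ∀ e ∈ stdSteps D,
      (0 ∈ goodSet 𝔄 ρ a ∧ e ∈ goodSet 𝔄 ρ a) →
      c₂ e (blockAt ρ a 0) = b (blockAt s a e) * c₁ e (blockAt ρ a 0) *
        (b (blockAt s a 0))⁻¹

/-- Extend a block to a configuration (arbitrarily outside the block). -/
noncomputable def blockExtend [Nonempty A] {ρ : ℕ} (p : ballZ D ρ → A) : Config D A :=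
  fun z => @dite A (z ∈ ballZ D ρ) (Classical.propDecidable _)
    (fun h => p ⟨z, h⟩) (fun _ => Classical.arbitrary A)

/-- The block map `Φ̄ : 𝔄_(r+R) → 𝔄_(r)` induced by a CA `Φ` of radius `R`. -/
noncomputable def blockMapCA [Nonempty A] (Φ : Config D A → Config D A) (R r : ℕ)
    (p : ballZ D (r + R) → A) : ballZ D r → A :=
  blockAt r (Φ (blockExtend p)) 0

/-- The pullback local rule `Φ_* c` of radius `r + R`. -/
noncomputable def pullRule [Nonempty A] {G : Type} [Group G]
    (Φ : Config D A → Config D A) (R r : ℕ)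
    (c : (Fin D → ℤ) → (ballZ D r → A) → G) :
    (Fin D → ℤ) → (ballZ D (r + R) → A) → G :=
  fun e p => c e (blockMapCA Φ R r p)

/-- Two local rules (of radii `r₁`, `r₂`) define the same class in
`H¹_loc(𝔄, G)`. -/
def SameHlocClass {G : Type} [CommGroup G] (𝔄 : Set (Config D A)) {r₁ r₂ : ℕ}
    (c₁ : (Fin D → ℤ) → (ballZ D r₁ → A) → G)
    (c₂ : (Fin D → ℤ) → (ballZ D r₂ → A) → G) : Prop :=
  ∃ (ρ : ℕ) (h₁ : r₁ ≤ ρ) (h₂ : r₂ ≤ ρ) (h : (Fin D → ℤ) → G),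
    (∀ y z : Fin D → ℤ, h (y + z) = h y * h z) ∧
    LocallyCohomologous 𝔄 ρ (liftRule h₁ c₁) fun e p => liftRule h₂ c₂ e p * h e

/-- `a` has a projective `G`-pole: a projective `c`-pole for some `G`-valued
local rule `c` of some radius. -/
def HasProjGPole (G : Type) [Group G] (𝔄 : Set (Config D A)) (a : Config D A) : Prop :=
  ∃ (r : ℕ) (c : (Fin D → ℤ) → (ballZ D r → A) → G),
    IsLocalRule 𝔄 r c ∧ HasProjPole 𝔄 r c a

/-- A locally fundamental local rule (valued in a discrete abelian group). -/
def IsLocallyFundamental {Gs : Type} [CommGroup Gs] (𝔄 : Set (Config D A)) (rstar : ℕ)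
    (cstar : (Fin D → ℤ) → (ballZ D rstar → A) → Gs) : Prop :=
  ∀ (H : Type) [CommGroup H], ∀ (r : ℕ) (c : (Fin D → ℤ) → (ballZ D r → A) → H),
    IsLocalRule 𝔄 r c →
    ∃ (ψ : Gs →* H) (ρ : ℕ) (h₁ : rstar ≤ ρ) (h₂ : r ≤ ρ),
      LocallyCohomologous 𝔄 ρ (liftRule h₁ fun e p => ψ (cstar e p)) (liftRule h₂ c)

/-- A pseudonorm on `G`, with values in `[0, ∞]`. -/
def IsPseudonorm {G : Type} [Group G] (ν : G → ℝ≥0∞) : Prop :=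
  ν 1 = 0 ∧ (∀ g h : G, ν (g * h) = ν (h * g)) ∧ ∀ g h : G, ν (g * h) ≤ ν g + ν h

/-- The `ℓ¹`-norm on `ℤ^D`. -/
def l1norm {D : ℕ} (v : Fin D → ℤ) : ℕ := ∑ i, (v i).natAbs


/-! ### Additive dynamical and equivariant cocycles -/

/-- A continuous `(G,+)`-valued dynamical cocycle on `𝔄`. -/
def AddDynCocycleOn [TopologicalSpace A] {G : Type} [AddCommGroup G] [TopologicalSpace G]
    (𝔄 : Set (Config D A)) (C : (Fin D → ℤ) → Config D A → G) : Prop :=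
  (∀ z : Fin D → ℤ, ContinuousOn (C z) 𝔄) ∧
    ∀ y z : Fin D → ℤ, ∀ a ∈ 𝔄, C (y + z) a = C y (shift z a) + C z a

/-- Cohomologous additive cocycles. -/
def AddDynCohomologous [TopologicalSpace A] {G : Type} [AddCommGroup G] [TopologicalSpace G]
    (𝔄 : Set (Config D A)) (C C' : (Fin D → ℤ) → Config D A → G) : Prop :=
  ∃ b : Config D A → G, ContinuousOn b 𝔄 ∧
    ∀ z : Fin D → ℤ, ∀ a ∈ 𝔄, C' z a = b (shift z a) + C z a - b a

/-- The equivariant edge cocycle `Ψ(C̃)(x→y; a) = C̃(y−x, σ^x(a))` associated to a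
dynamical cocycle. -/
def edgeCocycleOf {G : Type} [AddCommGroup G] (C : (Fin D → ℤ) → Config D A → G) :
    (Fin D → ℤ) → (Fin D → ℤ) → Config D A → G :=
  fun x y a => C (y - x) (shift x a)

/-- A continuous equivariant 1-cocycle on `𝔄` (as a function of oriented edges
`x → y`, i.e. pairs with `y - x ∈ E`). -/
def IsEqCocycle [TopologicalSpace A] {G : Type} [AddCommGroup G] [TopologicalSpace G]
    (𝔄 : Set (Config D A)) (C : (Fin D → ℤ) → (Fin D → ℤ) → Config D A → G) : Prop :=
  (∀ x y : Fin D → ℤ, y - x ∈ stdSteps D → ContinuousOn (C x y) 𝔄) ∧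
  (∀ x y z : Fin D → ℤ, y - x ∈ stdSteps D → ∀ a ∈ 𝔄,
      C x y (shift z a) = C (x + z) (y + z) a) ∧
  (∀ x y : Fin D → ℤ, y - x ∈ stdSteps D → ∀ a ∈ 𝔄, C y x a = -C x y a) ∧
  (∀ s : Fin D → ℤ, ∀ i j : Fin D, i ≠ j → ∀ a ∈ 𝔄,
      C s (s + Pi.single i 1) a +
        C (s + Pi.single i 1) (s + Pi.single i 1 + Pi.single j 1) a =
      C s (s + Pi.single j 1) a +
        C (s + Pi.single j 1) (s + Pi.single i 1 + Pi.single j 1) a)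

/-- Cohomologous equivariant 1-cocycles, via an equivariant continuous
0-cochain `B`. -/
def EqCohomologous [TopologicalSpace A] {G : Type} [AddCommGroup G] [TopologicalSpace G]
    (𝔄 : Set (Config D A)) (C C' : (Fin D → ℤ) → (Fin D → ℤ) → Config D A → G) : Prop :=
  ∃ B : (Fin D → ℤ) → Config D A → G,
    (∀ x : Fin D → ℤ, ContinuousOn (B x) 𝔄) ∧
    (∀ x z : Fin D → ℤ, ∀ a ∈ 𝔄, B x (shift z a) = B (x + z) a) ∧
    ∀ x y : Fin D → ℤ, y - x ∈ stdSteps D → ∀ a ∈ 𝔄,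
      C' x y a = B y a + C x y a - B x a

/-! ### Cells, chains, and equivariant `d`-cocycles -/

/-- A cell in `ℤ^D`: a base point together with a set of spanning directions. -/
abbrev Cell (D : ℕ) := (Fin D → ℤ) × Finset (Fin D)

/-- Chains: finitely supported `ℤ`-valued functions on cells. -/
abbrev CellChain (D : ℕ) := Cell D →₀ ℤ

/-- The boundary of a single cell. -/
noncomputable def cellBoundary {D : ℕ} (cell : Cell D) : CellChain D :=
  ∑ i ∈ cell.2, ((-1 : ℤ) ^ (cell.2.filter fun j => j < i).card) •
    (Finsupp.single (cell.1 + Pi.single i 1, cell.2.erase i) (1 : ℤ) -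
      Finsupp.single (cell.1, cell.2.erase i) (1 : ℤ))

/-- The boundary homomorphism on chains. -/
noncomputable def chainBoundary {D : ℕ} (ζ : CellChain D) : CellChain D :=
  ζ.sum fun cell n => n • cellBoundary cell

/-- The value of an equivariant cochain (of radius `r`) on a chain. -/
def chainVal {G : Type} [AddCommGroup G] {r : ℕ}
    (c : Finset (Fin D) → (ballZ D r → A) → G) (a : Config D A) (ζ : CellChain D) : G :=
  ζ.sum fun cell n => n • c cell.2 (blockAt r a cell.1)

/-- An equivariant `d`-cocycle of radius `r` on `𝔄`: vanishes on boundaries of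
`(d+1)`-cells over admissible configurations. -/
def IsEqDCocycle {G : Type} [AddCommGroup G] (𝔄 : Set (Config D A)) (d r : ℕ)
    (c : Finset (Fin D) → (ballZ D r → A) → G) : Prop :=
  ∀ a ∈ 𝔄, ∀ cell : Cell D, cell.2.card = d + 1 →
    chainVal c a (cellBoundary cell) = 0

/-- `a` has a projective `(G,d)`-pole. -/
def HasProjDPole (G : Type) [AddCommGroup G] (𝔄 : Set (Config D A)) (d : ℕ)
    (a : Config D A) : Prop :=
  ∃ (r : ℕ) (c : Finset (Fin D) → (ballZ D r → A) → G),
    IsEqDCocycle 𝔄 d r c ∧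
    ∀ R : ℕ, r ≤ R → ∃ ζ : CellChain D,
      (∀ cell ∈ ζ.support, (cell : Cell D).2.card = d) ∧
      chainBoundary ζ = 0 ∧
      (∀ cell ∈ ζ.support, (cell : Cell D).1 ∈ goodSet 𝔄 R a) ∧
      chainVal c a ζ ≠ 0

theorem blockAt_shift (r : ℕ) (a : Config D A) (x z : Fin D → ℤ) :
    blockAt r (shift x a) z = blockAt r a (z + x) := by
  funext w
  simp only [blockAt, shift]
  rw [add_right_comm]

theorem mem_goodSet_shift {𝔄 : Set (Config D A)} {r : ℕ} {a : Config D A}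
    {x z : Fin D → ℤ} : z ∈ goodSet 𝔄 r (shift x a) ↔ z + x ∈ goodSet 𝔄 r a := by
  simp only [goodSet, Set.mem_ofPred_eq, blockAt_shift]

theorem goodSet_anti {𝔄 : Set (Config D A)} {r ρ : ℕ} (h : r ≤ ρ) (a : Config D A) :
    goodSet 𝔄 ρ a ⊆ goodSet 𝔄 r a := by
  rintro z ⟨b, hb, hbz⟩
  exact ⟨b, hb, congrArg (restrictBlock h) hbz⟩

theorem goodSet_eq_univ [TopologicalSpace A] {𝔄 : Set (Config D A)} (h𝔄 : IsSubshift 𝔄)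
    {a : Config D A} (ha : a ∈ 𝔄) (r : ℕ) : goodSet 𝔄 r a = Set.univ := by
  refine Set.eq_univ_of_forall fun z => ⟨shift z a, ?_, ?_⟩
  · rw [← h𝔄.2.2 z]
    exact ⟨a, ha, rfl⟩
  · simp only [blockAt_shift, zero_add]

/-- A map of radius `R` sends configurations with equal `(r + R)`-blocks to configurations with
equal `r`-blocks. -/
theorem HasRadius.blockAt_eq {Φ : Config D A → Config D A} {R : ℕ} (hR : HasRadius Φ R)
    {r : ℕ} {a b : Config D A} {z : Fin D → ℤ}
    (h : blockAt (r + R) a z = blockAt (r + R) b z) :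
    blockAt r (Φ a) z = blockAt r (Φ b) z := by
  funext w
  refine hR a b _ (funext fun v => ?_)
  have hmem : w.1 + v.1 ∈ ballZ D (r + R) := fun i => by
    have hw := w.2 i
    have hv := v.2 i
    push_cast
    exact (abs_add_le _ _).trans (add_le_add hw hv)
  simpa only [blockAt, add_assoc] using congrFun h ⟨_, hmem⟩

theorem blockAt_blockExtend [Nonempty A] {ρ : ℕ} (p : ballZ D ρ → A) :
    blockAt ρ (blockExtend p) 0 = p := by
  funext w
  simp [blockAt, blockExtend]

theorem blockMapCA_blockAt [Nonempty A] {Φ : Config D A → Config D A}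
    (hΦ : ∀ v : Fin D → ℤ, Φ ∘ shift v = shift v ∘ Φ) {R : ℕ} (hR : HasRadius Φ R)
    (r : ℕ) (a : Config D A) (z : Fin D → ℤ) :
    blockMapCA Φ R r (blockAt (r + R) a z) = blockAt r (Φ a) z := by
  have h : blockAt r (Φ (blockExtend (blockAt (r + R) a z))) 0 =
      blockAt r (Φ (shift z a)) 0 :=
    hR.blockAt_eq (by rw [blockAt_blockExtend, blockAt_shift, zero_add])
  rw [blockMapCA, h, show Φ (shift z a) = shift z (Φ a) from congrFun (hΦ z) a,
    blockAt_shift, zero_add]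

theorem goodSet_subset_goodSet_map {𝔄 : Set (Config D A)} {Φ : Config D A → Config D A}
    (hΦ : ∀ v : Fin D → ℤ, Φ ∘ shift v = shift v ∘ Φ) {R : ℕ} (hR : HasRadius Φ R)
    (hinv : Φ '' 𝔄 ⊆ 𝔄) (r : ℕ) (a : Config D A) :
    goodSet 𝔄 (r + R) a ⊆ goodSet 𝔄 r (Φ a) := by
  rintro z ⟨b, hb, hbz⟩
  refine ⟨Φ b, hinv ⟨b, hb, rfl⟩, ?_⟩
  have h : blockAt r (Φ b) 0 = blockAt r (Φ (shift z a)) 0 :=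
    hR.blockAt_eq (hbz.trans (by rw [blockAt_shift, zero_add]))
  refine h.trans ?_
  rw [show Φ (shift z a) = shift z (Φ a) from congrFun (hΦ z) a, blockAt_shift, zero_add]

section TrailValues

variable {G : Type}

theorem trailVal_liftRule [Group G] {r ρ : ℕ} (h : r ≤ ρ)
    (c : (Fin D → ℤ) → (ballZ D r → A) → G) (a : Config D A) :
    ∀ ζ : List (Fin D → ℤ), trailVal (liftRule h c) a ζ = trailVal c a ζ
  | [] => rfl
  | [_] => rfl
  | x :: y :: l => by
    simp only [trailVal, trailVal_liftRule h c a (y :: l)]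
    rfl

theorem trailVal_pullRule [Group G] [Nonempty A] {Φ : Config D A → Config D A}
    (hΦ : ∀ v : Fin D → ℤ, Φ ∘ shift v = shift v ∘ Φ) {R : ℕ} (hR : HasRadius Φ R) {r : ℕ}
    (c : (Fin D → ℤ) → (ballZ D r → A) → G) (a : Config D A) :
    ∀ ζ : List (Fin D → ℤ), trailVal (pullRule Φ R r c) a ζ = trailVal c (Φ a) ζ
  | [] => rfl
  | [_] => rfl
  | x :: y :: l => by
    simp only [trailVal, trailVal_pullRule hΦ hR c a (y :: l), pullRule,
      blockMapCA_blockAt hΦ hR]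

theorem trailVal_mul_hom [CommGroup G] {r : ℕ} (c : (Fin D → ℤ) → (ballZ D r → A) → G)
    {h : (Fin D → ℤ) → G} (hh : ∀ y z : Fin D → ℤ, h (y + z) = h y * h z)
    (a : Config D A) (l : List (Fin D → ℤ)) (x : Fin D → ℤ) :
    trailVal (fun e p => c e p * h e) a (x :: l) =
      trailVal c a (x :: l) * h ((x :: l).getLast (List.cons_ne_nil x l) - x) := by
  induction l generalizing x with
  | nil =>
    have h0 : h 0 = 1 := by simpa using hh 0 0
    simp [trailVal, h0]
  | cons y l ih =>
    simp only [trailVal, ih, List.getLast_cons_cons]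
    rw [← sub_add_sub_cancel ((y :: l).getLast _) y x, hh, mul_mul_mul_comm]

theorem LocallyCohomologous.trailVal_eq [Group G] {𝔄 : Set (Config D A)} {ρ : ℕ}
    {c₁ c₂ : (Fin D → ℤ) → (ballZ D ρ → A) → G} (h : LocallyCohomologous 𝔄 ρ c₁ c₂)
    (a : Config D A) :
    ∃ β : (Fin D → ℤ) → G, ∀ (l : List (Fin D → ℤ)) (x : Fin D → ℤ),
      IsTrail (x :: l) → TrailIn (goodSet 𝔄 ρ a) (x :: l) →
        trailVal c₂ a (x :: l) =
          β ((x :: l).getLast (List.cons_ne_nil x l)) * trailVal c₁ a (x :: l) * (β x)⁻¹ := by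
  obtain ⟨s, -, b, hb⟩ := h
  refine ⟨fun z => b (blockAt s a z), fun l => ?_⟩
  induction l with
  | nil => simp [trailVal]
  | cons y l ih =>
    rintro x ⟨-, hchain⟩ hin
    replace hchain := List.isChain_cons_cons.mp hchain
    have hstep := hb (shift x a) (y - x) hchain.1
      ⟨by simpa [mem_goodSet_shift] using hin x (by simp),
        by simpa [mem_goodSet_shift] using hin y (by simp)⟩
    simp only [blockAt_shift, zero_add, sub_add_cancel] at hstep
    simp only [trailVal, List.getLast_cons_cons, hstep,
      ih y ⟨List.cons_ne_nil y l, hchain.2⟩ fun z hz => hin z (List.mem_cons_of_mem x hz)]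
    group

theorem IsClosedTrail.getLast_eq {l : List (Fin D → ℤ)} {x : Fin D → ℤ}
    (h : IsClosedTrail (x :: l)) : (x :: l).getLast (List.cons_ne_nil x l) = x := by
  rw [IsClosedTrail, List.getLast?_eq_getLast_of_ne_nil (List.cons_ne_nil x l)] at h
  simpa using h.symm

theorem LocallyCohomologous.trailVal_eq_of_isClosedTrail [CommGroup G] {𝔄 : Set (Config D A)}
    {ρ : ℕ} {c₁ c₂ : (Fin D → ℤ) → (ballZ D ρ → A) → G} {h : (Fin D → ℤ) → G}
    (hh : ∀ y z : Fin D → ℤ, h (y + z) = h y * h z)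
    (hc : LocallyCohomologous 𝔄 ρ c₁ fun e p => c₂ e p * h e)
    {a : Config D A} {ζ : List (Fin D → ℤ)} (hζ : IsTrail ζ) (hclosed : IsClosedTrail ζ)
    (hin : TrailIn (goodSet 𝔄 ρ a) ζ) : trailVal c₁ a ζ = trailVal c₂ a ζ := by
  obtain ⟨x, l, rfl⟩ := List.exists_cons_of_ne_nil hζ.1
  obtain ⟨β, hβ⟩ := hc.trailVal_eq a
  have h0 : h 0 = 1 := by simpa using hh 0 0
  have key := hβ l x hζ hin
  rw [trailVal_mul_hom c₂ hh, hclosed.getLast_eq, sub_self, h0, mul_one,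
    mul_comm (β x), mul_inv_cancel_right] at key
  exact key.symm

end TrailValues

section Admissible

variable {G : Type} [Group G] [TopologicalSpace A] {𝔄 : Set (Config D A)} {r : ℕ}
  {c : (Fin D → ℤ) → (ballZ D r → A) → G}

theorem neg_mem_stdSteps {e : Fin D → ℤ} (he : e ∈ stdSteps D) : -e ∈ stdSteps D := by
  obtain ⟨i, rfl | rfl⟩ := he
  · exact ⟨i, Or.inr rfl⟩
  · exact ⟨i, Or.inl (neg_neg _)⟩

theorem IsLocalRule.comm_of_mem (h𝔄 : IsSubshift 𝔄) (hc : IsLocalRule 𝔄 r c)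
    {a : Config D A} (ha : a ∈ 𝔄) {e e' : Fin D → ℤ} (he : e ∈ stdSteps D)
    (he' : e' ∈ stdSteps D) (x : Fin D → ℤ) :
    c e' (blockAt r a (x + e)) * c e (blockAt r a x) =
      c e (blockAt r a (x + e')) * c e' (blockAt r a x) := by
  have h := (hc (shift x a) e he e' he').1
    (by simp [mem_goodSet_shift, goodSet_eq_univ h𝔄 ha])
  simpa only [blockAt_shift, zero_add, add_zero, add_comm _ x] using h

theorem IsLocalRule.neg_of_mem (h𝔄 : IsSubshift 𝔄) (hc : IsLocalRule 𝔄 r c)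
    {a : Config D A} (ha : a ∈ 𝔄) {e : Fin D → ℤ} (he : e ∈ stdSteps D) (x : Fin D → ℤ) :
    c (-e) (blockAt r a (x + e)) = (c e (blockAt r a x))⁻¹ := by
  have h := (hc (shift x a) e he e he).2
    (by simp [mem_goodSet_shift, goodSet_eq_univ h𝔄 ha])
  simpa only [blockAt_shift, zero_add, add_zero, add_comm _ x] using h

/-- Over an admissible configuration, a local rule extends to an action of `ℤ^D` on the skew
product `ℤ^D × G`. -/
theorem IsLocalRule.exists_skewAction (h𝔄 : IsSubshift 𝔄) (hc : IsLocalRule 𝔄 r c)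
    {a : Config D A} (ha : a ∈ 𝔄) :
    ∃ F : (Fin D → ℤ) → Equiv.Perm ((Fin D → ℤ) × G), F 0 = 1 ∧
      (∀ v w, F (v + w) = F v * F w) ∧
      ∀ e ∈ stdSteps D, ∀ x g, F e (x, g) = (x + e, c e (blockAt r a x) * g) := by
  have hmem (i : Fin D) : (Pi.single i 1 : Fin D → ℤ) ∈ stdSteps D := ⟨i, Or.inl rfl⟩
  let T (i : Fin D) : Equiv.Perm ((Fin D → ℤ) × G) :=
    { toFun := fun q => (q.1 + Pi.single i 1, c (Pi.single i 1) (blockAt r a q.1) * q.2)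
      invFun := fun q => (q.1 + -Pi.single i 1, c (-Pi.single i 1) (blockAt r a q.1) * q.2)
      left_inv := fun ⟨x, g⟩ => by
        simp [hc.neg_of_mem h𝔄 ha (hmem i)]
      right_inv := fun ⟨x, g⟩ => by
        have h := hc.neg_of_mem h𝔄 ha (neg_mem_stdSteps (hmem i)) x
        rw [neg_neg] at h
        simp only [h, inv_mul_cancel_left, neg_add_cancel_right] }
  have hT (i j : Fin D) : Commute (T i) (T j) := by
    refine Equiv.ext fun ⟨x, g⟩ => Prod.ext (add_right_comm x _ _) ?_
    change c _ (blockAt r a (x + _)) * (c _ _ * g) = c _ (blockAt r a (x + _)) * (c _ _ * g)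
    simpa only [← mul_assoc] using
      congrArg (· * g) (hc.comm_of_mem h𝔄 ha (hmem j) (hmem i) x)
  let φ (i : Fin D) : Multiplicative ℤ →* Equiv.Perm ((Fin D → ℤ) × G) := zpowersHom _ (T i)
  have hφ : Pairwise fun i j => ∀ m n, Commute (φ i m) (φ j n) :=
    fun i j _ m n => (hT i j).zpow_zpow _ _
  let ψ := MonoidHom.noncommPiCoprod φ hφ
  have hψ (i : Fin D) (n : ℤ) :
      ψ (fun j => Multiplicative.ofAdd ((Pi.single i n : Fin D → ℤ) j)) = T i ^ n := by
    rw [show (fun j => Multiplicative.ofAdd ((Pi.single i n : Fin D → ℤ) j)) =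
        Pi.mulSingle i (Multiplicative.ofAdd n) from rfl]
    exact MonoidHom.noncommPiCoprod_mulSingle _ _ _
  refine ⟨fun v => ψ fun j => Multiplicative.ofAdd (v j), map_one ψ,
    fun v w => map_mul ψ _ _, ?_⟩
  rintro e ⟨i, rfl | rfl⟩ x g
  · simp only [hψ, zpow_one]
    rfl
  · simp only [← Pi.single_neg, hψ, zpow_neg, zpow_one]
    simp only [Pi.single_neg]
    rfl

theorem IsLocalRule.trailVal_eq_one (h𝔄 : IsSubshift 𝔄) (hc : IsLocalRule 𝔄 r c)
    {a : Config D A} (ha : a ∈ 𝔄) {ζ : List (Fin D → ℤ)} (hζ : IsTrail ζ)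
    (hclosed : IsClosedTrail ζ) : trailVal c a ζ = 1 := by
  obtain ⟨F, hF0, hFadd, hF⟩ := hc.exists_skewAction h𝔄 ha
  have key (l : List (Fin D → ℤ)) : ∀ x, IsTrail (x :: l) → ∀ g,
      F ((x :: l).getLast (List.cons_ne_nil x l) - x) (x, g) =
        ((x :: l).getLast (List.cons_ne_nil x l), trailVal c a (x :: l) * g) := by
    induction l with
    | nil => simp [trailVal, hF0]
    | cons y l ih =>
      rintro x ⟨-, hchain⟩ g
      replace hchain := List.isChain_cons_cons.mp hchain
      have h := ih y ⟨List.cons_ne_nil y l, hchain.2⟩ (c (y - x) (blockAt r a x) * g)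
      rw [List.getLast_cons_cons, ← sub_add_sub_cancel ((y :: l).getLast _) y x, hFadd, Equiv.Perm.mul_apply,
        hF _ hchain.1, add_sub_cancel, h, trailVal, mul_assoc]
  obtain ⟨x, l, rfl⟩ := List.exists_cons_of_ne_nil hζ.1
  have h := key l x hζ 1
  rw [hclosed.getLast_eq, sub_self, hF0] at h
  simpa using (congrArg Prod.snd h).symm

theorem not_hasProjGPole_of_mem (h𝔄 : IsSubshift 𝔄) {a : Config D A} (ha : a ∈ 𝔄) :
    ¬ HasProjGPole G 𝔄 a := by
  rintro ⟨r, c, hc, hpole⟩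
  obtain ⟨ζ, hζ, hclosed, -, hne⟩ := hpole r le_rfl
  exact hne (hc.trailVal_eq_one h𝔄 ha hζ hclosed)

end Admissible

theorem HasProjGPole.map [Nonempty A] {𝔄 : Set (Config D A)} {G : Type} [CommGroup G]
    {Φ : Config D A → Config D A} (hΦ : ∀ v : Fin D → ℤ, Φ ∘ shift v = shift v ∘ Φ)
    {R : ℕ} (hR : HasRadius Φ R) (hinv : Φ '' 𝔄 ⊆ 𝔄)
    (hsurj : ∀ (r₂ : ℕ) (c₂ : (Fin D → ℤ) → (ballZ D r₂ → A) → G),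
        IsLocalRule 𝔄 r₂ c₂ →
        ∃ (r₁ : ℕ) (c₁ : (Fin D → ℤ) → (ballZ D r₁ → A) → G),
          IsLocalRule 𝔄 r₁ c₁ ∧ SameHlocClass 𝔄 (pullRule Φ R r₁ c₁) c₂)
    {a : Config D A} (hpole : HasProjGPole G 𝔄 a) : HasProjGPole G 𝔄 (Φ a) := by
  obtain ⟨r₂, c₂, hc₂, hpole⟩ := hpole
  obtain ⟨r₁, c₁, hc₁, ρ, h₁, h₂, h, hh, hcoh⟩ := hsurj r₂ c₂ hc₂
  refine ⟨r₁, c₁, hc₁, fun R' _ => ?_⟩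
  obtain ⟨ζ, hζ, hclosed, hin, hne⟩ :=
    hpole (max ρ (R' + R)) (h₂.trans (le_max_left _ _))
  refine ⟨ζ, hζ, hclosed, fun z hz => goodSet_subset_goodSet_map hΦ hR hinv R' a
    (goodSet_anti (le_max_right _ _) a (hin z hz)), ?_⟩
  have heq := hcoh.trailVal_eq_of_isClosedTrail hh hζ hclosed
    fun z hz => goodSet_anti (le_max_left _ _) a (hin z hz)
  rw [trailVal_liftRule, trailVal_liftRule, trailVal_pullRule hΦ hR] at heq
  rwa [heq]

theorem statement_11 {D : ℕ} (hD : 1 ≤ D) {A : Type} [Fintype A] [Nonempty A]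
    [TopologicalSpace A] [DiscreteTopology A]
    (𝔄 : Set (Config D A)) (h𝔄 : IsSubshift 𝔄)
    {G : Type} [CommGroup G]
    (Φ : Config D A → Config D A) (hΦ : IsCellularAutomaton Φ)
    (R : ℕ) (hR : HasRadius Φ R) (hinv : Φ '' 𝔄 ⊆ 𝔄)
    -- surjectivity of the induced endomorphism `Φ_*` of `H¹_loc(𝔄,G)`:
    -- every class of a local rule is the class of a pullback
    (hsurj : ∀ (r₂ : ℕ) (c₂ : (Fin D → ℤ) → (ballZ D r₂ → A) → G),
        IsLocalRule 𝔄 r₂ c₂ →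
        ∃ (r₁ : ℕ) (c₁ : (Fin D → ℤ) → (ballZ D r₁ → A) → G),
          IsLocalRule 𝔄 r₁ c₁ ∧ SameHlocClass 𝔄 (pullRule Φ R r₁ c₁) c₂)
    (a : Config D A) (ha : a ∈ almostAdmissible 𝔄)
    (hpole : HasProjGPole G 𝔄 a) :
    HasProjGPole G 𝔄 (Φ a) ∧ (∀ t : ℕ, HasProjGPole G 𝔄 (Φ^[t] a)) ∧
      ∀ t : ℕ, Φ^[t] a ∉ 𝔄 := by
  have hiter (t : ℕ) : HasProjGPole G 𝔄 (Φ^[t] a) := by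
    induction t with
    | zero => exact hpole
    | succ t ih =>
      rw [Function.iterate_succ_apply']
      exact ih.map hΦ.2 hR hinv hsurj
  exact ⟨hiter 1, hiter, fun t ht => not_hasProjGPole_of_mem h𝔄 ht (hiter t)⟩

end Defects
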